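/- Let C_ω^n be an edge-weighted cycle on vertex set [n] in which exactly two edges have non-trivial weight (weight at least 2), and let I = I(C_ω^n) be its edge ideal. If I is integrally closed, then I is normal, i.e., I^k is integrally closed for every k ≥ 1. -/

import Mathlib

open MvPolynomial

/-- The edge ideal of an edge-weighted graph `G` with weight function `w`. -/
noncomputable def edgeIdeal (K : Type*) [Field K] {n : ℕ}
    (G : SimpleGraph (Fin n)) (w : Sym2 (Fin n) → ℕ) :
    Ideal (MvPolynomial (Fin n) K) :=
  Ideal.span {m | ∃ i j : Fin n, G.Adj i j ∧ m = X i ^ w s(i, j) * X j ^ w s(i, j)}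

/-- The integral closure of an ideal `I`. -/
def intClosure {R : Type*} [CommRing R] (I : Ideal R) : Set R :=
  {f | ∃ k : ℕ, 0 < k ∧ ∃ c : ℕ → R,
    (∀ i ∈ Finset.Icc 1 k, c i ∈ I ^ i) ∧
    f ^ k + ∑ i ∈ Finset.Icc 1 k, c i * f ^ (k - i) = 0}

/-- An ideal is integrally closed if it equals its integral closure. -/
def IsIntClosed {R : Type*} [CommRing R] (I : Ideal R) : Prop :=
  intClosure I = ↑I

section WeightedOrder

variable {K σ : Type*} [Field K]

/-- The ideal of polynomials all of whose monomials have `L`-weight at least `d`. -/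
noncomputable def weightIdeal (K : Type*) [Field K] {σ : Type*} (L : σ → ℕ) (d : ℕ) :
    Ideal (MvPolynomial σ K) where
  carrier := {f | (d : ℕ∞) ≤ (f : MvPowerSeries σ K).weightedOrder L}
  zero_mem' := by simp
  add_mem' {f g} hf hg := by
    simp only [Set.mem_ofPred_eq, MvPolynomial.coe_add] at *
    exact (le_min hf hg).trans (MvPowerSeries.min_weightedOrder_le_add L)
  smul_mem' f g hg := by
    simp only [Set.mem_ofPred_eq, smul_eq_mul, MvPolynomial.coe_mul,
      MvPowerSeries.weightedOrder_mul] at *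
    exact hg.trans le_add_self

lemma mem_weightIdeal {L : σ → ℕ} {d : ℕ} {f : MvPolynomial σ K} :
    f ∈ weightIdeal K L d ↔ (d : ℕ∞) ≤ (f : MvPowerSeries σ K).weightedOrder L :=
  Iff.rfl

lemma monomial_mem_weightIdeal {L : σ → ℕ} {d : ℕ} {u : σ →₀ ℕ} (h : d ≤ Finsupp.weight L u) :
    monomial u (1 : K) ∈ weightIdeal K L d := by
  rw [mem_weightIdeal, MvPolynomial.coe_monomial,
    MvPowerSeries.weightedOrder_monomial_of_ne_zero L one_ne_zero]
  exact_mod_cast h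

lemma le_weight_of_mem_weightIdeal {L : σ → ℕ} {d : ℕ} {f : MvPolynomial σ K}
    (hf : f ∈ weightIdeal K L d) {u : σ →₀ ℕ} (hu : u ∈ f.support) :
    d ≤ Finsupp.weight L u := by
  have h := MvPowerSeries.weightedOrder_le L (f := (f : MvPowerSeries σ K)) (d := u)
    (by rw [MvPolynomial.coeff_coe]; exact mem_support_iff.mp hu)
  exact_mod_cast (mem_weightIdeal.mp hf).trans h

lemma weightIdeal_mul_le (L : σ → ℕ) (d e : ℕ) :
    weightIdeal K L d * weightIdeal K L e ≤ weightIdeal K L (d + e) := by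
  rw [Ideal.mul_le]
  intro f hf g hg
  rw [mem_weightIdeal] at *
  rw [MvPolynomial.coe_mul, MvPowerSeries.weightedOrder_mul, Nat.cast_add]
  exact add_le_add hf hg

lemma pow_le_weightIdeal {L : σ → ℕ} {d : ℕ} {J : Ideal (MvPolynomial σ K)}
    (hJ : J ≤ weightIdeal K L d) (k : ℕ) : J ^ k ≤ weightIdeal K L (k * d) := by
  induction k with
  | zero => intro f _; simp [mem_weightIdeal]
  | succ k ih =>
    rw [pow_succ, Nat.succ_mul]
    exact (Ideal.mul_mono ih hJ).trans (weightIdeal_mul_le L _ _)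

lemma weightedOrder_pow (L : σ → ℕ) (f : MvPowerSeries σ K) (k : ℕ) :
    (f ^ k).weightedOrder L = k * f.weightedOrder L := by
  induction k with
  | zero => simp [MvPowerSeries.weightedOrder_one]
  | succ k ih => rw [pow_succ, MvPowerSeries.weightedOrder_mul, ih]; push_cast; ring

/-- Elements integral over an ideal contained in a monomial valuation ideal stay in the latter. -/
lemma intClosure_subset_weightIdeal {L : σ → ℕ} {d : ℕ} {J : Ideal (MvPolynomial σ K)}
    (hJ : J ≤ weightIdeal K L d) : intClosure J ⊆ weightIdeal K L d := by
  rintro f ⟨k, hk, c, hc, hf⟩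
  by_contra hlt
  rw [SetLike.mem_coe, mem_weightIdeal, not_le] at hlt
  obtain ⟨r, hr⟩ := ENat.ne_top_iff_exists.mp (ne_top_of_lt hlt)
  rw [← hr, Nat.cast_lt] at hlt
  have hsum : ∑ i ∈ Finset.Icc 1 k, c i * f ^ (k - i) ∈ weightIdeal K L (k * r + 1) := by
    refine Ideal.sum_mem _ fun i hi => ?_
    have hci := pow_le_weightIdeal hJ i (hc i hi)
    rw [mem_weightIdeal] at hci ⊢
    rw [MvPolynomial.coe_mul, MvPolynomial.coe_pow, MvPowerSeries.weightedOrder_mul,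
      weightedOrder_pow, ← hr]
    refine le_trans ?_ (add_le_add_left hci _)
    norm_cast
    obtain ⟨h1, h2⟩ := Finset.mem_Icc.mp hi
    obtain ⟨j, rfl⟩ := Nat.exists_eq_add_of_le h2
    rw [Nat.add_sub_cancel_left]
    nlinarith
  have hpow : f ^ k ∈ weightIdeal K L (k * r + 1) := by
    rw [eq_neg_of_add_eq_zero_left hf]
    exact neg_mem hsum
  rw [mem_weightIdeal, MvPolynomial.coe_pow, weightedOrder_pow, ← hr] at hpow
  norm_cast at hpow
  omega

end WeightedOrder

lemma subset_intClosure {R : Type*} [CommRing R] (I : Ideal R) : (I : Set R) ⊆ intClosure I := by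
  intro f hf
  refine ⟨1, one_pos, fun _ => -f, ?_, by simp⟩
  simpa using hf

lemma mem_intClosure_of_sq_mem {R : Type*} [CommRing R] {I : Ideal R} {f : R}
    (hf : f ^ 2 ∈ I ^ 2) : f ∈ intClosure I := by
  refine ⟨2, two_pos, fun i => if i = 2 then -f ^ 2 else 0, ?_, ?_⟩
  · intro i _
    dsimp only
    split_ifs with h
    · subst h; exact neg_mem hf
    · exact zero_mem _
  · simp [show Finset.Icc 1 2 = {1, 2} from rfl]

lemma weight_add_left {σ : Type*} (L M : σ → ℕ) (u : σ →₀ ℕ) :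
    Finsupp.weight (L + M) u = Finsupp.weight L u + Finsupp.weight M u := by
  simp only [Finsupp.weight_apply, Pi.add_apply, smul_eq_mul, mul_add, Finsupp.sum,
    Finset.sum_add_distrib]

lemma weight_smul_left {σ : Type*} (a : ℕ) (L : σ → ℕ) (u : σ →₀ ℕ) :
    Finsupp.weight (a • L) u = a * Finsupp.weight L u := by
  simp only [Finsupp.weight_apply, Pi.smul_apply, smul_eq_mul, Finsupp.sum, Finset.mul_sum,
    mul_left_comm]

/-- A greedy matching along a path `q 0, …, q m` with capacities `u`: it has size `c`, leaves `s`
units of capacity at the end `q m`, and is certified optimal by two vertex covers `L` and `L'`,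
the second of which contains `q m`. -/
lemma exists_greedy_matching {K σ : Type*} [Field K] (I : Ideal (MvPolynomial σ K))
    (u : σ →₀ ℕ) (q : ℕ → σ) (m : ℕ) (hq : ∀ i ≤ m, ∀ j ≤ m, q i = q j → i = j)
    (hI : ∀ j < m, monomial (Finsupp.single (q j) 1 + Finsupp.single (q (j + 1)) 1) (1 : K) ∈ I) :
    ∃ (c s : ℕ) (d : σ →₀ ℕ) (L L' : σ → ℕ),
      monomial d (1 : K) ∈ I ^ c ∧ d ≤ u ∧ d (q m) + s ≤ u (q m) ∧
      (∀ x, (∀ i ≤ m, x ≠ q i) → d x = 0) ∧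
      (∀ j < m, 1 ≤ L (q j) + L (q (j + 1))) ∧ (∀ j < m, 1 ≤ L' (q j) + L' (q (j + 1))) ∧
      1 ≤ L' (q m) ∧ Finsupp.weight L u = c ∧ Finsupp.weight L' u = c + s := by
  classical
  induction m with
  | zero =>
    refine ⟨0, u (q 0), 0, 0, Pi.single (q 0) 1, by simp, by simp, by simp, by simp, by simp,
      by simp, by simp, by simp [Finsupp.weight_apply], ?_⟩
    rw [Finsupp.weight_single_one_apply]; simp
  | succ m ih =>
    obtain ⟨c, s, d, L, L', hd, hdu, hs, hd0, hL, hL', hm, hLu, hLu'⟩ := ih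
      (fun i hi j hj => hq i (by omega) j (by omega)) (fun j hj => hI j (by omega))
    set v := u (q (m + 1)) with hv
    obtain ⟨N, hN⟩ : ∃ N : σ → ℕ, N = L + Pi.single (q (m + 1)) 1 := ⟨_, rfl⟩
    have hne : q m ≠ q (m + 1) := fun h => by have := hq _ (by omega) _ le_rfl h; omega
    have hnew : d (q (m + 1)) = 0 := hd0 _ fun i hi h => by
      have := hq _ le_rfl i (by omega) h; omega
    have hcov : ∀ j < m + 1, 1 ≤ N (q j) +
        N (q (j + 1)) := by
      intro j hj
      rcases Nat.lt_succ_iff_lt_or_eq.mp hj with h | rfl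
      · have := hL j h
        simp only [hN, Pi.add_apply]; omega
      · simp only [hN, Pi.add_apply, Pi.single_eq_same]; omega
    have hw : Finsupp.weight N u = c + v := by
      rw [hN, weight_add_left, Finsupp.weight_single_one_apply, hLu]
    set r := min s v with hr
    obtain ⟨e, he⟩ : ∃ e : σ →₀ ℕ,
        e = d + r • (Finsupp.single (q m) 1 + Finsupp.single (q (m + 1)) 1) := ⟨_, rfl⟩
    have hmem : monomial e (1 : K)
        ∈ I ^ (c + r) := by
      have h := Ideal.mul_mem_mul hd (Ideal.pow_mem_pow (hI m (by omega)) r)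
      rwa [monomial_pow, one_pow, monomial_mul, one_mul, ← pow_add, ← he] at h
    have hle : e ≤ u := by
      intro x
      have hx := hdu x
      by_cases h1 : q m = x
      · subst h1
        simp [he, hne.symm]; omega
      · by_cases h2 : q (m + 1) = x
        · subst h2
          simp [he, hne, hnew]; omega
        · simpa [he, h1, h2, Finsupp.single_apply] using hx
    have hsupp : ∀ x, (∀ i ≤ m + 1, x ≠ q i) →
        e x = 0 := by
      intro x hx
      have h1 := hx m (by omega)
      have h2 := hx (m + 1) le_rfl
      simp [he, h1.symm, h2.symm, hd0 x fun i hi => hx i (by omega)]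
    have hend : e (q (m + 1))
        + (v - r) ≤ v := by
      simp [he, hne, hnew]; omega
    rcases le_total s v with h | h
    · refine ⟨c + r, v - r, _, L', N, hmem, hle, hend, hsupp, ?_, hcov,
        by simp [hN], by omega, by omega⟩
      intro j hj
      rcases Nat.lt_succ_iff_lt_or_eq.mp hj with h | rfl
      · exact hL' j h
      · omega
    · exact ⟨c + r, v - r, _, N, N, hmem, hle,
        hend, hsupp, hcov, hcov, by simp [hN], by omega, by omega⟩

section Cycle

variable {K σ : Type*} [Field K] {n : ℕ}

/-- The exponent vector of the generator attached to the edge `{φ k, φ (k + 1)}` of a cycle. -/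
noncomputable def edgeExponent (φ : ZMod n → σ) (W : ZMod n → ℕ) (k : ZMod n) : σ →₀ ℕ :=
  Finsupp.single (φ k) (W k) + Finsupp.single (φ (k + 1)) (W k)

/-- The edge ideal of the cycle with vertices `φ k`, whose edge `{φ k, φ (k + 1)}` has
weight `W k`. -/
noncomputable def cycleIdeal (K : Type*) [Field K] (φ : ZMod n → σ) (W : ZMod n → ℕ) :
    Ideal (MvPolynomial σ K) :=
  Ideal.span ((fun d => monomial d (1 : K)) '' Set.range (edgeExponent φ W))

lemma monomial_edgeExponent_mem (φ : ZMod n → σ) (W : ZMod n → ℕ) (k : ZMod n) :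
    monomial (edgeExponent φ W k) (1 : K) ∈ cycleIdeal K φ W :=
  Ideal.subset_span ⟨_, ⟨k, rfl⟩, rfl⟩

lemma monomial_mem_cycleIdeal {φ : ZMod n → σ} {W : ZMod n → ℕ} {d : σ →₀ ℕ} :
    monomial d (1 : K) ∈ cycleIdeal K φ W ↔ ∃ k, edgeExponent φ W k ≤ d := by
  rw [cycleIdeal, mem_ideal_span_monomial_image]
  classical
  simp [support_monomial]

lemma monomial_mem_of_le {I : Ideal (MvPolynomial σ K)} {d u : σ →₀ ℕ}
    (hd : monomial d (1 : K) ∈ I) (h : d ≤ u) (a : K) : monomial u a ∈ I := by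
  have := I.mul_mem_left (monomial (u - d) a) hd
  rwa [monomial_mul, mul_one, tsub_add_cancel_of_le h] at this

lemma cycleIdeal_le_weightIdeal {φ : ZMod n → σ} {W : ZMod n → ℕ} {L : σ → ℕ} {a : ℕ}
    (h : ∀ k, a ≤ W k * (L (φ k) + L (φ (k + 1)))) :
    cycleIdeal K φ W ≤ weightIdeal K L a := by
  rw [cycleIdeal, Ideal.span_le]
  rintro _ ⟨_, ⟨k, rfl⟩, rfl⟩
  refine monomial_mem_weightIdeal ?_
  simpa [edgeExponent, map_add, Finsupp.weight_single, mul_add] using h k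

lemma cycleIdeal_rotate (φ : ZMod n → σ) (W : ZMod n → ℕ) (c : ZMod n) :
    cycleIdeal K (fun k => φ (k + c)) (fun k => W (k + c)) = cycleIdeal K φ W := by
  have : edgeExponent (fun k => φ (k + c)) (fun k => W (k + c)) =
      edgeExponent φ W ∘ Equiv.addRight c := by
    funext k
    simp [edgeExponent, add_right_comm]
  rw [cycleIdeal, cycleIdeal, this, EquivLike.range_comp]

lemma cycleIdeal_reflect (φ : ZMod n → σ) (W : ZMod n → ℕ) (c : ZMod n) :
    cycleIdeal K (fun k => φ (c + 1 - k)) (fun k => W (c - k)) = cycleIdeal K φ W := by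
  have : edgeExponent (fun k => φ (c + 1 - k)) (fun k => W (c - k)) =
      edgeExponent φ W ∘ Equiv.subLeft c := by
    funext k
    simp only [edgeExponent, Function.comp, Equiv.subLeft_apply, add_sub_add_right_eq_sub]
    rw [add_comm, show c - k + 1 = c + 1 - k by ring]
  rw [cycleIdeal, cycleIdeal, this, EquivLike.range_comp]

lemma natCast_zmod_ne_zero {j : ℕ} (h0 : 0 < j) (hj : j < n) : (j : ZMod n) ≠ 0 := fun h =>
  absurd (Nat.le_of_dvd h0 ((ZMod.natCast_eq_zero_iff _ _).mp h)) (by omega)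

lemma monomial_mem_pow_of_intClosure_of_le (hn : 3 ≤ n) {φ : ZMod n → σ}
    (hφ : Function.Injective φ) {W : ZMod n → ℕ} (hW0 : 2 ≤ W 0) (hW2 : 2 ≤ W 2)
    (hW : ∀ k, k ≠ 0 → k ≠ 2 → W k = 1) {k : ℕ} {f : MvPolynomial σ K}
    (hf : f ∈ intClosure (cycleIdeal K φ W ^ k)) {u : σ →₀ ℕ} (hu : u ∈ f.support)
    (h21 : u (φ 2) ≤ u (φ 1)) (a : K) : monomial u a ∈ cycleIdeal K φ W ^ k := by
  classical
  have : NeZero n := ⟨by omega⟩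
  have n1 : (1 : ZMod n) ≠ 0 := by
    simpa using natCast_zmod_ne_zero (n := n) (j := 1) (by omega) (by omega)
  have n2 : (2 : ZMod n) ≠ 0 := by
    simpa using natCast_zmod_ne_zero (n := n) (j := 2) (by omega) (by omega)
  have hW1 : W 1 = 1 := hW 1 n1 fun h => n1 (by linear_combination -h)
  have hWq : ∀ j < n - 3, W ((3 : ZMod n) + (j : ℕ)) = 1 := by
    intro j hj
    refine hW _ (fun h => ?_) (fun h => ?_)
    · exact natCast_zmod_ne_zero (n := n) (j := 3 + j) (by omega) (by omega)
        (by push_cast; exact h)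
    · exact natCast_zmod_ne_zero (n := n) (j := 1 + j) (by omega) (by omega)
        (by push_cast; linear_combination h)
  have hlast : (3 : ZMod n) + ((n - 3 : ℕ) : ZMod n) = 0 := by
    have : ((3 + (n - 3) : ℕ) : ZMod n) = 0 := by
      rw [Nat.add_sub_cancel' hn, ZMod.natCast_self]
    exact_mod_cast this
  have hq1 : ∀ i ≤ n - 3, φ 1 ≠ φ (3 + (i : ℕ)) := fun i hi h =>
    natCast_zmod_ne_zero (n := n) (j := i + 2) (by omega) (by omega)
      (by push_cast; linear_combination -hφ h)
  have hq2 : ∀ i ≤ n - 3, φ 2 ≠ φ (3 + (i : ℕ)) := fun i hi h =>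
    natCast_zmod_ne_zero (n := n) (j := i + 1) (by omega) (by omega)
      (by push_cast; linear_combination -hφ h)
  obtain ⟨c, s, d, L, L', hd, hdu, hs, hd0, hL, hL', hm, hLu, hLu'⟩ :=
    exists_greedy_matching (cycleIdeal K φ W) u (fun j => φ (3 + (j : ℕ))) (n - 3)
      (fun i hi j hj h => by
        have := (ZMod.natCast_eq_natCast_iff' _ _ _).mp (add_left_cancel (hφ h))
        rwa [Nat.mod_eq_of_lt (by omega), Nat.mod_eq_of_lt (by omega)] at this)
      (fun j hj => by
        have := monomial_edgeExponent_mem (K := K) φ W (3 + (j : ℕ))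
        rw [edgeExponent, hWq j hj, add_assoc] at this
        exact_mod_cast this)
  have hd1 := hd0 _ hq1
  have hd2 := hd0 _ hq2
  simp only [hlast] at hs hm
  have hcase : ∀ k : ZMod n, k = 0 ∨ k = 1 ∨ k = 2 ∨ ∃ j < n - 3, k = 3 + (j : ℕ) := by
    intro k
    have hk := ZMod.natCast_zmod_val k
    have hlt := ZMod.val_lt k
    rcases Nat.lt_or_ge k.val 3 with h | h
    · interval_cases k.val
      · left; simpa using hk.symm
      · right; left; simpa using hk.symm
      · right; right; left; simpa using hk.symm
    · refine .inr (.inr (.inr ⟨k.val - 3, by omega, ?_⟩))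
      conv_lhs => rw [← hk, ← Nat.add_sub_cancel' h]
      push_cast
      rfl
  set A := W 0 with hA
  have key : ∀ M : σ → ℕ, A ≤ A * (M (φ 0) + M (φ 1)) → A ≤ M (φ 1) + M (φ 2) →
      A ≤ 2 * M (φ 2) →
      (∀ j < n - 3, A ≤ M (φ (3 + (j : ℕ))) + M (φ (3 + ((j + 1 : ℕ) : ZMod n)))) →
      k * A ≤ Finsupp.weight M u := by
    intro M h0 h1 h2 h3
    have hle : cycleIdeal K φ W ≤ weightIdeal K M A := by
      refine cycleIdeal_le_weightIdeal fun k => ?_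
      rcases hcase k with rfl | rfl | rfl | ⟨j, hj, rfl⟩
      · simpa using h0
      · rw [hW1, one_mul, one_add_one_eq_two]; exact h1
      · rw [show (2 : ZMod n) + 1 = 3 by norm_num]
        exact h2.trans (Nat.mul_le_mul hW2 (Nat.le_add_right _ _))
      · rw [hWq j hj, one_mul, add_assoc]; exact_mod_cast h3 j hj
    exact le_weight_of_mem_weightIdeal
      (intClosure_subset_weightIdeal (pow_le_weightIdeal hle k) hf) hu
  have hbound : k ≤ c + u (φ 2) + min s (u (φ 1) - u (φ 2)) / A := by
    have hkA : k * A ≤ A * (c + u (φ 2)) + min s (u (φ 1) - u (φ 2)) := by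
      obtain ⟨B, hB⟩ : ∃ B, A = B + 1 := ⟨A - 1, by omega⟩
      rcases le_total (u (φ 1) - u (φ 2)) s with h | h
      · have := key (A • L + (Pi.single (φ 1) 1 + B • Pi.single (φ 2) 1)) ?_ ?_ ?_ ?_
        · rw [weight_add_left, weight_add_left, weight_smul_left, weight_smul_left,
            Finsupp.weight_single_one_apply, Finsupp.weight_single_one_apply, hLu] at this
          rw [min_eq_right h]
          refine this.trans (le_of_eq ?_)
          rw [hB]
          obtain ⟨x, hx⟩ := Nat.exists_eq_add_of_le h21
          rw [hx, Nat.add_sub_cancel_left]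
          ring
        · refine Nat.le_mul_of_pos_right _ ?_
          simp only [Pi.add_apply, Pi.single_eq_same]
          omega
        · simp only [Pi.add_apply, Pi.smul_apply, Pi.single_eq_same, smul_eq_mul]
          omega
        · simp only [Pi.add_apply, Pi.smul_apply, Pi.single_eq_same, smul_eq_mul]
          omega
        · intro j hj
          have := hL j hj
          simp only [Pi.add_apply, Pi.smul_apply, smul_eq_mul]
          nlinarith
      · have := key (B • L + (L' + A • Pi.single (φ 2) 1)) ?_ ?_ ?_ ?_
        · rw [weight_add_left, weight_add_left, weight_smul_left, weight_smul_left,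
            Finsupp.weight_single_one_apply, hLu, hLu'] at this
          rw [min_eq_left h]
          refine this.trans (le_of_eq ?_)
          rw [hB]
          ring
        · refine Nat.le_mul_of_pos_right _ ?_
          simp only [Pi.add_apply]
          omega
        · simp only [Pi.add_apply, Pi.smul_apply, Pi.single_eq_same, smul_eq_mul]
          omega
        · simp only [Pi.add_apply, Pi.smul_apply, Pi.single_eq_same, smul_eq_mul]
          omega
        · intro j hj
          have := hL j hj
          have := hL' j hj
          simp only [Pi.add_apply, Pi.smul_apply, smul_eq_mul]
          nlinarith
    have hdiv : k ≤ (A * (c + u (φ 2)) + min s (u (φ 1) - u (φ 2))) / A :=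
      (Nat.le_div_iff_mul_le (by omega)).mpr hkA
    rwa [Nat.mul_add_div (by omega)] at hdiv
  set t := min s (u (φ 1) - u (φ 2)) / A with ht
  have htA : t * A ≤ min s (u (φ 1) - u (φ 2)) := Nat.div_mul_le_self _ _
  have hmem : monomial (d + u (φ 2) • edgeExponent φ W 1 + t • edgeExponent φ W 0) (1 : K) ∈
      cycleIdeal K φ W ^ (c + u (φ 2) + t) := by
    have h := Ideal.mul_mem_mul (Ideal.mul_mem_mul hd (Ideal.pow_mem_pow
      (monomial_edgeExponent_mem (K := K) φ W 1) (u (φ 2)))) (Ideal.pow_mem_pow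
      (monomial_edgeExponent_mem (K := K) φ W 0) t)
    rwa [monomial_pow, monomial_pow, one_pow, one_pow, monomial_mul, monomial_mul, one_mul,
      one_mul, ← pow_add, ← pow_add] at h
  refine monomial_mem_of_le (Ideal.pow_le_pow_right hbound hmem) (fun x => ?_) a
  have h01 : φ 0 ≠ φ 1 := fun h => n1 (hφ h).symm
  have h02 : φ 0 ≠ φ 2 := fun h => n2 (hφ h).symm
  have h12 : φ 1 ≠ φ 2 := fun h => n1 (by linear_combination -hφ h)
  have hx := hdu x
  simp only [edgeExponent, hW1, ← hA, zero_add, one_add_one_eq_two, Finsupp.add_apply,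
    Finsupp.smul_apply, smul_eq_mul]
  by_cases e0 : φ 0 = x
  · subst e0
    simp [h01.symm, h02.symm]; omega
  · by_cases e1 : φ 1 = x
    · subst e1
      simp [h01, h12.symm, hd1]; omega
    · by_cases e2 : φ 2 = x
      · subst e2
        simp [h02, h12, hd2]
      · simpa [e0, e1, e2, Finsupp.single_apply] using hx

lemma isIntClosed_pow_cycleIdeal (hn : 3 ≤ n) {φ : ZMod n → σ}
    (hφ : Function.Injective φ) {W : ZMod n → ℕ} (hW0 : 2 ≤ W 0) (hW2 : 2 ≤ W 2)
    (hW : ∀ k, k ≠ 0 → k ≠ 2 → W k = 1) (k : ℕ) : IsIntClosed (cycleIdeal K φ W ^ k) := by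
  refine Set.Subset.antisymm (fun f hf => ?_) (subset_intClosure _)
  rw [SetLike.mem_coe, f.as_sum]
  refine Ideal.sum_mem _ fun u hu => ?_
  rcases le_total (u (φ 2)) (u (φ 1)) with h | h
  · exact monomial_mem_pow_of_intClosure_of_le hn hφ hW0 hW2 hW hf hu h _
  · rw [← cycleIdeal_reflect φ W 2] at hf ⊢
    refine monomial_mem_pow_of_intClosure_of_le hn (fun x y hxy => ?_) ?_ ?_ ?_ hf hu ?_ _
    · exact sub_right_injective (hφ hxy)
    · simpa using hW2
    · simpa using hW0
    · intro k h0 h2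
      exact hW _ (fun h => h2 (by linear_combination -h)) (fun h => h0 (by linear_combination -h))
    · rw [show (2 : ZMod n) + 1 - 2 = 1 by ring, show (2 : ZMod n) + 1 - 1 = 2 by ring]
      exact h

end Cycle

section NontrivialEdges

variable {K : Type*} [Field K] {n : ℕ}

/-- If the edge ideal of the cycle is integrally closed and a product of two generators divides the
square of a monomial, then some generator divides this monomial. -/
lemma exists_edgeExponent_le {σ : Type*} {φ : ZMod n → σ} {W : ZMod n → ℕ}
    (hic : IsIntClosed (cycleIdeal K φ W)) {d : σ →₀ ℕ} (i j : ZMod n)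
    (hd : edgeExponent φ W i + edgeExponent φ W j ≤ 2 • d) : ∃ k, edgeExponent φ W k ≤ d := by
  rw [← monomial_mem_cycleIdeal (K := K), ← SetLike.mem_coe, ← hic]
  refine mem_intClosure_of_sq_mem ?_
  rw [monomial_pow, one_pow]
  refine monomial_mem_of_le ?_ hd 1
  have := Ideal.mul_mem_mul (monomial_edgeExponent_mem (K := K) φ W i)
    (monomial_edgeExponent_mem (K := K) φ W j)
  rwa [monomial_mul, one_mul, ← pow_two] at this

lemma eq_three_of_adjacent {σ : Type*} (hn : 3 ≤ n) {φ : ZMod n → σ}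
    (hφ : Function.Injective φ) {W : ZMod n → ℕ} (hW : ∀ k, 1 ≤ W k)
    (hic : IsIntClosed (cycleIdeal K φ W)) {i : ZMod n} (hi : 2 ≤ W i) (hj : 2 ≤ W (i + 1)) :
    (3 : ZMod n) = 0 := by
  classical
  by_contra n3
  have n1 : (1 : ZMod n) ≠ 0 := by
    simpa using natCast_zmod_ne_zero (n := n) (j := 1) (by omega) (by omega)
  have n2 : (2 : ZMod n) ≠ 0 := by
    simpa using natCast_zmod_ne_zero (n := n) (j := 2) (by omega) (by omega)
  have h01 : φ i ≠ φ (i + 1) := fun h => n1 (by linear_combination -hφ h)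
  have h02 : φ i ≠ φ (i + 1 + 1) := fun h => n2 (by linear_combination -hφ h)
  have h12 : φ (i + 1) ≠ φ (i + 1 + 1) := fun h => n1 (by linear_combination -hφ h)
  obtain ⟨d, hd⟩ : ∃ d : σ →₀ ℕ, d = Finsupp.single (φ i) (W i - 1) +
    Finsupp.single (φ (i + 1)) (max (W i) (W (i + 1))) +
    Finsupp.single (φ (i + 1 + 1)) (W (i + 1) - 1) := ⟨_, rfl⟩
  obtain ⟨k, hk⟩ := exists_edgeExponent_le hic (d := d) i (i + 1) fun x => by
    simp only [hd, edgeExponent, Finsupp.add_apply, Finsupp.smul_apply, Finsupp.single_apply,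
      smul_eq_mul]
    split_ifs <;> omega
  have hmem : ∀ x, 1 ≤ d (φ x) → x = i ∨ x = i + 1 ∨ x = i + 1 + 1 := by
    intro x hx
    by_contra! h
    rw [hd] at hx
    simp [hφ.eq_iff, h.1.symm, h.2.1.symm, h.2.2.symm] at hx
  have hk0 := hk (φ k)
  have hk1 := hk (φ (k + 1))
  have hkne : φ k ≠ φ (k + 1) := fun h => n1 (by linear_combination -hφ h)
  have hWk := hW k
  simp only [edgeExponent, Finsupp.add_apply, Finsupp.single_eq_same,
    Finsupp.single_eq_of_ne hkne, Finsupp.single_eq_of_ne hkne.symm, add_zero, zero_add]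
    at hk0 hk1
  rcases hmem k (by omega) with h | h | h
  · subst h
    simp [hd, h01, h02] at hk0
    omega
  · subst h
    simp [hd, h02.symm, h12.symm] at hk1
    omega
  · subst h
    rcases hmem _ (hWk.trans hk1) with h | h | h
    · exact n3 (by linear_combination h)
    · exact n2 (by linear_combination h)
    · exact n1 (by linear_combination h)

lemma close_of_nontrivial {σ : Type*} (hn : 3 ≤ n) {φ : ZMod n → σ}
    (hφ : Function.Injective φ) {W : ZMod n → ℕ} (hW : ∀ k, 1 ≤ W k)
    (hic : IsIntClosed (cycleIdeal K φ W)) {i j : ZMod n} (hi : 2 ≤ W i) (hj : 2 ≤ W j)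
    (hij : i ≠ j) (hij1 : j ≠ i + 1) (hji1 : i ≠ j + 1) : j = i + 2 ∨ i = j + 2 := by
  classical
  by_contra! ⟨hij2, hji2⟩
  have n1 : (1 : ZMod n) ≠ 0 := by
    simpa using natCast_zmod_ne_zero (n := n) (j := 1) (by omega) (by omega)
  have n2 : (2 : ZMod n) ≠ 0 := by
    simpa using natCast_zmod_ne_zero (n := n) (j := 2) (by omega) (by omega)
  have hi1 : i ≠ i + 1 := fun h => n1 (by linear_combination -h)
  have hj1 : j ≠ j + 1 := fun h => n1 (by linear_combination -h)
  have hij3 : i + 1 ≠ j + 1 := fun h => hij (by linear_combination h)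
  obtain ⟨d, hd⟩ : ∃ d : σ →₀ ℕ, d = Finsupp.single (φ i) (W i - 1) +
    Finsupp.single (φ (i + 1)) (W i - 1) + Finsupp.single (φ j) (W j - 1) +
    Finsupp.single (φ (j + 1)) (W j - 1) := ⟨_, rfl⟩
  obtain ⟨k, hk⟩ := exists_edgeExponent_le hic (d := d) i j fun x => by
    simp only [hd, edgeExponent, Finsupp.add_apply, Finsupp.smul_apply, Finsupp.single_apply,
      smul_eq_mul]
    split_ifs <;> omega
  have hmem : ∀ x, 1 ≤ d (φ x) → x = i ∨ x = i + 1 ∨ x = j ∨ x = j + 1 := by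
    intro x hx
    by_contra! h
    rw [hd] at hx
    simp [hφ.eq_iff, h.1.symm, h.2.1.symm, h.2.2.1.symm,
      h.2.2.2.symm] at hx
  have hk0 := hk (φ k)
  have hk1 := hk (φ (k + 1))
  have hkne : φ k ≠ φ (k + 1) := fun h => n1 (by linear_combination -hφ h)
  have hWk := hW k
  simp only [edgeExponent, Finsupp.add_apply, Finsupp.single_eq_same,
    Finsupp.single_eq_of_ne hkne, Finsupp.single_eq_of_ne hkne.symm, add_zero, zero_add]
    at hk0 hk1
  rcases hmem k (hWk.trans hk0) with rfl | rfl | rfl | rfl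
  · simp [hd, hφ.eq_iff, hi1.symm, hij.symm, hji1.symm] at hk0
    omega
  · rcases hmem _ (hWk.trans hk1) with h | h | h | h
    · exact n2 (by linear_combination h)
    · exact n1 (by linear_combination h)
    · exact hij2 (by linear_combination -h)
    · exact hij1 (by linear_combination -h)
  · simp [hd, hφ.eq_iff, hj1.symm, hij, hij1.symm] at hk0
    omega
  · rcases hmem _ (hWk.trans hk1) with h | h | h | h
    · exact hji2 (by linear_combination -h)
    · exact hji1 (by linear_combination -h)
    · exact n2 (by linear_combination h)
    · exact n1 (by linear_combination h)

/-- In a cycle whose edge ideal is integrally closed, two distinct edges of non-trivial weight are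
joined by an edge. -/
lemma exists_distance_two {σ : Type*} (hn : 3 ≤ n) {φ : ZMod n → σ}
    (hφ : Function.Injective φ) {W : ZMod n → ℕ} (hW : ∀ k, 1 ≤ W k)
    (hic : IsIntClosed (cycleIdeal K φ W)) {i j : ZMod n} (hi : 2 ≤ W i) (hj : 2 ≤ W j)
    (hij : i ≠ j) : j = i + 2 ∨ i = j + 2 := by
  by_cases h1 : j = i + 1
  · have h3 := eq_three_of_adjacent hn hφ hW hic hi (h1 ▸ hj)
    exact .inr (by linear_combination -h1 - h3)
  by_cases h2 : i = j + 1
  · have h3 := eq_three_of_adjacent hn hφ hW hic hj (h2 ▸ hi)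
    exact .inl (by linear_combination -h2 - h3)
  exact close_of_nontrivial hn hφ hW hic hi hj hij h1 h2

/-- The enumeration of the vertices of a cycle on `Fin n` by `ZMod n`. -/
def cycleVertex (n : ℕ) [NeZero n] (k : ZMod n) : Fin n := ⟨k.val, ZMod.val_lt k⟩

lemma cycleVertex_injective [NeZero n] : Function.Injective (cycleVertex n) :=
  fun _ _ h => ZMod.val_injective n (Fin.mk.inj h)

lemma cycleVertex_natCast [NeZero n] (i : Fin n) : cycleVertex n (i.val : ZMod n) = i :=
  Fin.ext (ZMod.val_cast_of_lt i.isLt)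

lemma succ_mod_eq_iff [NeZero n] (i j : Fin n) :
    (i.val + 1) % n = j.val ↔ j = cycleVertex n ((i.val : ZMod n) + 1) := by
  have h : (cycleVertex n ((i.val : ZMod n) + 1)).val = (i.val + 1) % n := by
    exact_mod_cast ZMod.val_natCast n (i.val + 1)
  rw [Fin.ext_iff, h, eq_comm]

end NontrivialEdges

/-- Let `C_ω^n` be an edge-weighted cycle on `[n]` with exactly two edges of
non-trivial weight (weight ≥ 2). If its edge ideal is integrally closed, then it is
normal: every power `I^k`, `k ≥ 1`, is integrally closed. -/
theorem edgeIdeal_cycle_two_nontrivial_normal_of_intClosed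
    (K : Type*) [Field K] {n : ℕ} (hn : 3 ≤ n)
    (G : SimpleGraph (Fin n)) (w : Sym2 (Fin n) → ℕ)
    (hG : ∀ i j : Fin n, G.Adj i j ↔
      ((i.val + 1) % n = j.val ∨ (j.val + 1) % n = i.val))
    (hw : ∀ e ∈ G.edgeSet, 1 ≤ w e)
    (h2 : {e ∈ G.edgeSet | 2 ≤ w e}.ncard = 2)
    (hic : IsIntClosed (edgeIdeal K G w)) :
    ∀ k : ℕ, 1 ≤ k → IsIntClosed (edgeIdeal K G w ^ k) := by
  have : NeZero n := ⟨by omega⟩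
  have hadj : ∀ k, G.Adj (cycleVertex n k) (cycleVertex n (k + 1)) := fun k =>
    (hG _ _).mpr (.inl ((succ_mod_eq_iff _ _).mpr (by
      rw [show ((cycleVertex n k).val : ZMod n) = k from ZMod.natCast_zmod_val k])))
  have hadj' : ∀ i j, G.Adj i j → ∃ k, s(i, j) = s(cycleVertex n k, cycleVertex n (k + 1)) := by
    intro i j h
    rcases (hG i j).mp h with h | h <;> rw [succ_mod_eq_iff] at h
    · exact ⟨i.val, by rw [cycleVertex_natCast, ← h]⟩
    · exact ⟨j.val, by rw [cycleVertex_natCast, ← h, Sym2.eq_swap]⟩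
  obtain ⟨W, hWdef⟩ : ∃ W : ZMod n → ℕ,
    ∀ k, W k = w s(cycleVertex n k, cycleVertex n (k + 1)) := ⟨_, fun _ => rfl⟩
  have hgen : ∀ (i j : Fin n) (a : ℕ), (X i ^ a * X j ^ a : MvPolynomial (Fin n) K) =
      monomial (Finsupp.single i a + Finsupp.single j a) 1 := by
    intro i j a
    rw [X_pow_eq_monomial, X_pow_eq_monomial, monomial_mul, one_mul]
  have hideal : edgeIdeal K G w = cycleIdeal K (cycleVertex n) W := by
    rw [edgeIdeal, cycleIdeal]
    congr 1
    ext m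
    constructor
    · rintro ⟨i, j, h, rfl⟩
      obtain ⟨k, hk⟩ := hadj' i j h
      refine ⟨_, ⟨k, rfl⟩, ?_⟩
      dsimp only
      rw [hgen, hk, edgeExponent, hWdef]
      rcases Sym2.eq_iff.mp hk with ⟨rfl, rfl⟩ | ⟨rfl, rfl⟩
      · rfl
      · rw [add_comm]
    · rintro ⟨_, ⟨k, rfl⟩, rfl⟩
      exact ⟨_, _, hadj k, by rw [hgen, ← hWdef]; rfl⟩
  have hW : ∀ k, 1 ≤ W k := fun k => by rw [hWdef]; exact hw _ (hadj k)
  have hφ := cycleVertex_injective (n := n)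
  rw [hideal] at hic ⊢
  obtain ⟨e, e', hne, hset⟩ := Set.ncard_eq_two.mp h2
  have hedge : ∀ e ∈ ({e ∈ G.edgeSet | 2 ≤ w e} : Set (Sym2 (Fin n))),
      ∃ k, e = s(cycleVertex n k, cycleVertex n (k + 1)) := by
    intro e he
    induction e with
    | h x y => exact hadj' x y he.1
  have he : e ∈ {e ∈ G.edgeSet | 2 ≤ w e} := by simp [hset]
  have he' : e' ∈ {e ∈ G.edgeSet | 2 ≤ w e} := by simp [hset]
  obtain ⟨i, rfl⟩ := hedge e he
  obtain ⟨j, rfl⟩ := hedge e' he'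
  have hi : 2 ≤ W i := by rw [hWdef]; exact he.2
  have hj : 2 ≤ W j := by rw [hWdef]; exact he'.2
  have hij : i ≠ j := by rintro rfl; exact hne rfl
  have n2 : (2 : ZMod n) ≠ 0 := by
    simpa using natCast_zmod_ne_zero (n := n) (j := 2) (by omega) (by omega)
  have hinj : ∀ k l, s(cycleVertex n k, cycleVertex n (k + 1)) =
      s(cycleVertex n l, cycleVertex n (l + 1)) → k = l := by
    intro k l h
    rcases Sym2.eq_iff.mp h with ⟨h, -⟩ | ⟨h, h'⟩
    · exact hφ h
    · exact absurd (by linear_combination hφ h' - hφ h) n2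
  have hone : ∀ k, k ≠ i → k ≠ j → W k = 1 := by
    intro k hki hkj
    refine le_antisymm ?_ (hW k)
    by_contra! hlt
    have hmem : s(cycleVertex n k, cycleVertex n (k + 1)) ∈ {e ∈ G.edgeSet | 2 ≤ w e} :=
      ⟨hadj k, by rw [← hWdef]; exact hlt⟩
    rw [hset] at hmem
    rcases hmem with h | h
    · exact hki (hinj _ _ h)
    · exact hkj (hinj _ _ h)
  have main : ∀ a b : ZMod n, b = a + 2 → 2 ≤ W a → 2 ≤ W b → (∀ k, k ≠ a → k ≠ b → W k = 1) →
      ∀ k, IsIntClosed (cycleIdeal K (cycleVertex n) W ^ k) := by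
    rintro a _ rfl ha hb hrest k
    rw [← cycleIdeal_rotate (cycleVertex n) W a]
    refine isIntClosed_pow_cycleIdeal hn (fun x y h => add_right_cancel (hφ h)) ?_ ?_ ?_ k
    · rwa [zero_add]
    · rwa [add_comm]
    · intro l h0 h2
      exact hrest _ (fun h => h0 (by linear_combination h)) (fun h => h2 (by linear_combination h))
  intro k _
  rcases exists_distance_two hn hφ hW hic hi hj hij with h | h
  · exact main i j h hi hj hone k
  · exact main j i h hj hi (fun k hkj hki => hone k hki hkj) k
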